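/- arXiv:cs/0510019 — 2 statements merged into one kernel-verified Lean document; each statement's English description precedes it below -/
import Mathlib

section
/- Fix D > 0. For c > 0 let U be uniform on [0, D] and Z ~ N(0, 1/c²) independent of U, and let M(c, D) = (1/D)·∫₀^D H( ⌊(x + Z)/D⌋ ) dx denote the conditional base-2 Shannon entropy of the integer-valued random variable ⌊(U + Z)/D⌋ given U. Then as c → ∞, c·D·M(c, D) converges to 2α = 2·∫₀^∞ H₂(Φ(x)) dx. (This is the entropy I(h(p) − h(q) | r(q)) of the interval-hash difference for two points at distance 1/c, given the offset of q inside its length-D interval.) -/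
open ProbabilityTheory Filter

/-- `Φ(x)`: the upper tail of the standard normal distribution. -/
noncomputable def stdNormalTail (x : ℝ) : ℝ :=
  (Real.sqrt (2 * Real.pi))⁻¹ * ∫ t in Set.Ioi x, Real.exp (-(t ^ 2) / 2)

/-- Binary entropy function (base 2), with the convention `0 · log₂ 0 = 0`. -/
noncomputable def binEnt (w : ℝ) : ℝ :=
  -(w * Real.logb 2 w) - (1 - w) * Real.logb 2 (1 - w)

/-- `ι(w) = −w·log₂ w`, with the convention `ι(0) = 0`. -/
noncomputable def entTerm (w : ℝ) : ℝ := -(w * Real.logb 2 w)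

open MeasureTheory Set

theorem stdNormalTail_eq_real_Ici (x : ℝ) :
    stdNormalTail x = (gaussianReal 0 1).real (Ici x) := by
  have := nullSingletonClass_gaussianReal (μ := 0) (v := 1) one_ne_zero
  rw [measureReal_congr Ioi_ae_eq_Ici.symm, Measure.real,
    gaussianReal_apply_eq_integral 0 one_ne_zero,
    ENNReal.toReal_ofReal (integral_nonneg fun t => gaussianPDFReal_nonneg 0 1 t), stdNormalTail,
    ← integral_const_mul]
  simp [gaussianPDFReal_def]

theorem stdNormalTail_nonneg (x : ℝ) : 0 ≤ stdNormalTail x := by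
  rw [stdNormalTail_eq_real_Ici]
  exact measureReal_nonneg

theorem stdNormalTail_le_one (x : ℝ) : stdNormalTail x ≤ 1 := by
  rw [stdNormalTail_eq_real_Ici]
  exact measureReal_le_one

theorem stdNormalTail_antitone : Antitone stdNormalTail := fun x y hxy => by
  simp only [stdNormalTail_eq_real_Ici]
  exact measureReal_mono (Ici_subset_Ici.2 hxy)

theorem stdNormalTail_neg (x : ℝ) : stdNormalTail (-x) = 1 - stdNormalTail x := by
  have := nullSingletonClass_gaussianReal (μ := 0) (v := 1) one_ne_zero
  have hneg : Measure.map (fun x : ℝ => -x) (gaussianReal 0 1) = gaussianReal 0 1 := by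
    rw [gaussianReal_map_neg, neg_zero]
  have hpre : (fun x : ℝ => -x) ⁻¹' Ici (-x) = Iic x := by
    ext t
    simp
  rw [stdNormalTail_eq_real_Ici, stdNormalTail_eq_real_Ici]
  nth_rewrite 1 [← hneg]
  rw [map_measureReal_apply measurable_neg measurableSet_Ici, hpre,
    measureReal_congr Iio_ae_eq_Iic.symm, ← compl_Ici,
    probReal_compl_eq_one_sub measurableSet_Ici]

theorem stdNormalTail_le_exp {x : ℝ} (hx : 0 ≤ x) :
    stdNormalTail x ≤ Real.exp (-x ^ 2 / 2) := by
  have h := measure_ge_le_exp_mul_mgf (μ := gaussianReal 0 1) (X := id) x hx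
    (integrable_exp_mul_gaussianReal x)
  rw [mgf_id_gaussianReal, ← Real.exp_add] at h
  rw [stdNormalTail_eq_real_Ici]
  refine h.trans_eq ?_
  congr 1
  push_cast
  ring

theorem gaussianReal_real_Ico {a b : ℝ} (hab : a ≤ b) :
    (gaussianReal 0 1).real (Ico a b) = stdNormalTail a - stdNormalTail b := by
  rw [stdNormalTail_eq_real_Ici, stdNormalTail_eq_real_Ici, ← Ici_sdiff_Ici,
    measureReal_sdiff (Ici_subset_Ici.2 hab) measurableSet_Ici]

theorem entTerm_eq (w : ℝ) : entTerm w = Real.negMulLog w / Real.log 2 := by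
  simp only [entTerm, Real.logb, Real.negMulLog]
  ring

theorem continuous_entTerm : Continuous entTerm := by
  have h : entTerm = fun w => Real.negMulLog w / Real.log 2 := funext entTerm_eq
  rw [h]
  exact Real.continuous_negMulLog.div_const _

theorem entTerm_nonneg {w : ℝ} (h0 : 0 ≤ w) (h1 : w ≤ 1) : 0 ≤ entTerm w := by
  rw [entTerm_eq]
  exact div_nonneg (Real.negMulLog_nonneg h0 h1) (Real.log_pos one_lt_two).le

theorem negMulLog_le_one_sub {w : ℝ} (h0 : 0 ≤ w) : Real.negMulLog w ≤ 1 - w := by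
  rcases h0.eq_or_lt with rfl | h
  · simp
  · have h2 := mul_le_mul_of_nonneg_left (Real.one_sub_inv_le_log_of_pos h) h0
    rw [mul_sub, mul_inv_cancel₀ h.ne'] at h2
    rw [Real.negMulLog]
    linarith

theorem negMulLog_sq_le {s : ℝ} (h0 : 0 ≤ s) : Real.negMulLog (s ^ 2) ≤ 2 * s := by
  have h := mul_le_mul_of_nonneg_left (negMulLog_le_one_sub h0) h0
  simp only [Real.negMulLog, Real.log_pow] at h ⊢
  push_cast
  nlinarith

/-- An integrable majorant for the entropy terms below. -/
noncomputable def entBound (u : ℝ) : ℝ := 2 / Real.log 2 * Real.exp (-(1 / 4) * u ^ 2)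

theorem entBound_nonneg (u : ℝ) : 0 ≤ entBound u :=
  mul_nonneg (div_nonneg zero_le_two (Real.log_pos one_lt_two).le) (Real.exp_nonneg _)

theorem integrable_entBound : Integrable entBound :=
  (integrable_exp_neg_mul_sq (by norm_num)).const_mul _

theorem entTerm_le_entBound {w u : ℝ} (h0 : 0 ≤ w)
    (hpos : 0 ≤ u → w ≤ Real.exp (-u ^ 2 / 2))
    (hneg : u < 0 → 1 - w ≤ 2 * Real.exp (-u ^ 2 / 2)) : entTerm w ≤ entBound u := by
  rw [entTerm_eq, entBound, div_mul_eq_mul_div]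
  refine div_le_div_of_nonneg_right ?_ (Real.log_pos one_lt_two).le
  rcases le_or_gt 0 u with hu | hu
  · have hs : Real.sqrt w ≤ Real.exp (-(1 / 4) * u ^ 2) := by
      refine Real.sqrt_le_iff.2 ⟨Real.exp_nonneg _, (hpos hu).trans_eq ?_⟩
      rw [← Real.exp_nat_mul]
      congr 1
      push_cast
      ring
    have := negMulLog_sq_le (Real.sqrt_nonneg w)
    rw [Real.sq_sqrt h0] at this
    linarith
  · have h1 := negMulLog_le_one_sub h0
    have h2 : Real.exp (-u ^ 2 / 2) ≤ Real.exp (-(1 / 4) * u ^ 2) :=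
      Real.exp_le_exp.2 (by nlinarith [sq_nonneg u])
    linarith [hneg hu]

theorem one_sub_stdNormalTail_le {u : ℝ} (hu : u ≤ 0) :
    1 - stdNormalTail u ≤ Real.exp (-u ^ 2 / 2) := by
  have := stdNormalTail_le_exp (neg_nonneg.2 hu)
  rwa [stdNormalTail_neg, neg_sq] at this

theorem entTerm_stdNormalTail_le (u : ℝ) : entTerm (stdNormalTail u) ≤ entBound u :=
  entTerm_le_entBound (stdNormalTail_nonneg u) stdNormalTail_le_exp fun hu => by
    linarith [one_sub_stdNormalTail_le hu.le, Real.exp_nonneg (-u ^ 2 / 2)]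

theorem integrable_entTerm_stdNormalTail :
    Integrable fun u => entTerm (stdNormalTail u) := by
  refine integrable_entBound.mono'
    (continuous_entTerm.measurable.comp
      stdNormalTail_antitone.measurable).aestronglyMeasurable (ae_of_all _ fun u => ?_)
  rw [Real.norm_of_nonneg (entTerm_nonneg (stdNormalTail_nonneg u) (stdNormalTail_le_one u))]
  exact entTerm_stdNormalTail_le u

theorem integral_entTerm_stdNormalTail :
    ∫ u, entTerm (stdNormalTail u) = ∫ x in Ioi (0 : ℝ), binEnt (stdNormalTail x) := by
  have hi := integrable_entTerm_stdNormalTail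
  have hn : ∫ u in Iic (0 : ℝ), entTerm (stdNormalTail u)
      = ∫ u in Ioi (0 : ℝ), entTerm (stdNormalTail (-u)) := by
    have := integral_comp_neg_Iic 0 fun u => entTerm (stdNormalTail (-u))
    simpa only [neg_neg, neg_zero] using this
  rw [← intervalIntegral.integral_Iic_add_Ioi (b := 0) hi.integrableOn hi.integrableOn, hn,
    ← integral_add hi.comp_neg.integrableOn hi.integrableOn]
  refine integral_congr_ae (ae_of_all _ fun x => ?_)
  simp only [stdNormalTail_neg, entTerm, binEnt]
  ring

/-- The entropy term of the event that a standard normal variable falls in `[u, u + L)`. -/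
noncomputable def windowEnt (L u : ℝ) : ℝ := entTerm (stdNormalTail u - stdNormalTail (u + L))

theorem measurable_windowEnt (L : ℝ) : Measurable (windowEnt L) :=
  continuous_entTerm.measurable.comp (stdNormalTail_antitone.measurable.sub
    (stdNormalTail_antitone.measurable.comp (measurable_id.add_const L)))

theorem windowEnt_nonneg {L : ℝ} (hL : 0 ≤ L) (u : ℝ) : 0 ≤ windowEnt L u := by
  have h := stdNormalTail_antitone (show u ≤ u + L by linarith)
  exact entTerm_nonneg (by linarith)
    (by linarith [stdNormalTail_le_one u, stdNormalTail_nonneg (u + L)])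

theorem windowEnt_reflect (L u : ℝ) : windowEnt L (-L - u) = windowEnt L u := by
  rw [windowEnt, windowEnt, show -L - u = -(u + L) by ring, show -(u + L) + L = -u by ring,
    stdNormalTail_neg, stdNormalTail_neg]
  congr 1
  ring

theorem windowEnt_le_entBound {L u : ℝ} (hL : 0 ≤ L) (hu : -L / 2 ≤ u) :
    windowEnt L u ≤ entBound u := by
  have h := stdNormalTail_antitone (show u ≤ u + L by linarith)
  refine entTerm_le_entBound (by linarith) (fun h0 => ?_) fun h0 => ?_
  · linarith [stdNormalTail_le_exp h0, stdNormalTail_nonneg (u + L)]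
  · have h1 := one_sub_stdNormalTail_le h0.le
    have h2 := stdNormalTail_antitone (show -u ≤ u + L by linarith)
    rw [stdNormalTail_neg] at h2
    linarith

theorem integrable_windowEnt {L : ℝ} (hL : 0 ≤ L) : Integrable (windowEnt L) := by
  refine (integrable_entBound.add (integrable_entBound.comp_sub_left (-L))).mono'
    (measurable_windowEnt L).aestronglyMeasurable (ae_of_all _ fun u => ?_)
  rw [Real.norm_of_nonneg (windowEnt_nonneg hL u)]
  simp only [Pi.add_apply]
  rcases le_total (-L / 2) u with hu | hu
  · linarith [windowEnt_le_entBound hL hu, entBound_nonneg (-L - u)]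
  · have := windowEnt_le_entBound hL (show -L / 2 ≤ -L - u by linarith)
    rw [windowEnt_reflect] at this
    linarith [entBound_nonneg u]

theorem integral_windowEnt (L : ℝ) :
    ∫ u, windowEnt L u = 2 * ∫ u in Ioi (-L / 2), windowEnt L u := by
  have h1 : ∫ u, windowEnt L u = ∫ s, windowEnt L (|s| - L / 2) := by
    rw [← integral_sub_right_eq_self (windowEnt L) (L / 2)]
    refine integral_congr_ae (ae_of_all _ fun s => ?_)
    rcases abs_choice s with h | h
    · simp only [h]
    · simp only [h]
      rw [← windowEnt_reflect]
      congr 1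
      ring
  have h2 : ∫ s in Ioi (0 : ℝ), windowEnt L (s - L / 2)
      = ∫ u in Ioi (-L / 2), windowEnt L u := by
    rw [← integral_indicator measurableSet_Ioi, ← integral_indicator measurableSet_Ioi,
      ← integral_sub_right_eq_self ((Ioi (-L / 2)).indicator (windowEnt L)) (L / 2)]
    refine integral_congr_ae (ae_of_all _ fun s => ?_)
    simp only [indicator, mem_Ioi]
    refine if_congr ?_ rfl rfl
    constructor <;> intro h <;> linarith
  rw [h1, integral_comp_abs (f := fun s => windowEnt L (s - L / 2)), h2]

theorem tendsto_stdNormalTail_atTop : Tendsto stdNormalTail atTop (nhds 0) := by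
  have h : Tendsto (fun x : ℝ => Real.exp (-x ^ 2 / 2)) atTop (nhds 0) := by
    refine Real.tendsto_exp_atBot.comp ?_
    have h2 : Tendsto (fun x : ℝ => x ^ 2 / 2) atTop atTop :=
      (tendsto_pow_atTop two_ne_zero).atTop_div_const two_pos
    simpa only [neg_div, Function.comp_def] using tendsto_neg_atTop_atBot.comp h2
  refine squeeze_zero' (Eventually.of_forall stdNormalTail_nonneg) ?_ h
  filter_upwards [eventually_ge_atTop 0] with x hx using stdNormalTail_le_exp hx

theorem tendsto_integral_windowEnt :
    Tendsto (fun L => ∫ u, windowEnt L u) atTop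
      (nhds (2 * ∫ x in Ioi (0 : ℝ), binEnt (stdNormalTail x))) := by
  simp_rw [integral_windowEnt, ← integral_entTerm_stdNormalTail,
    ← integral_indicator measurableSet_Ioi]
  refine Tendsto.const_mul 2 (tendsto_integral_filter_of_dominated_convergence entBound
    (Eventually.of_forall fun L =>
      ((measurable_windowEnt L).indicator measurableSet_Ioi).aestronglyMeasurable)
    ?_ integrable_entBound (ae_of_all _ fun u => ?_))
  · filter_upwards [eventually_ge_atTop 0] with L hL
    refine ae_of_all _ fun u => ?_
    by_cases hu : u ∈ Ioi (-L / 2)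
    · rw [indicator_of_mem hu, Real.norm_of_nonneg (windowEnt_nonneg hL u)]
      exact windowEnt_le_entBound hL (le_of_lt hu)
    · rw [indicator_of_notMem hu, norm_zero]
      exact entBound_nonneg u
  · have hlim : Tendsto (fun L => windowEnt L u) atTop (nhds (entTerm (stdNormalTail u))) := by
      refine (continuous_entTerm.tendsto _).comp ?_
      simpa using (tendsto_stdNormalTail_atTop.comp
        (tendsto_atTop_add_const_left atTop u tendsto_id)).const_sub (stdNormalTail u)
    refine hlim.congr' ?_
    filter_upwards [eventually_gt_atTop (-2 * u)] with L hL
    rw [indicator_of_mem]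
    rw [mem_Ioi]
    linarith

theorem gaussianReal_floor_eq {D c : ℝ} (hD : 0 < D) (hc : 0 < c) (t : ℝ) (i : ℤ) :
    entTerm ((gaussianReal 0 (Real.toNNReal (1 / c ^ 2)))
        {z : ℝ | ⌊(D * t + z) / D⌋ = i}).toReal
      = windowEnt (c * D) (-(c * D) * (t + (-i : ℤ))) := by
  have hmap : gaussianReal 0 (Real.toNNReal (1 / c ^ 2))
      = Measure.map (fun x => c⁻¹ * x) (gaussianReal 0 1) := by
    rw [gaussianReal_map_const_mul, mul_zero, mul_one, Real.toNNReal_of_nonneg (by positivity)]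
    congr 2
    field_simp
  have hset : (fun x => c⁻¹ * x) ⁻¹' {z : ℝ | ⌊(D * t + z) / D⌋ = i}
      = Ico (-(c * D) * (t + (-i : ℤ))) (-(c * D) * (t + (-i : ℤ)) + c * D) := by
    ext z
    have hz : z = c * (c⁻¹ * z) := by field_simp
    generalize c⁻¹ * z = y at hz
    subst hz
    have hleft : -(c * D) * (t + (-i : ℤ)) ≤ c * y ↔ i * D ≤ D * t + y := by
      rw [← mul_le_mul_iff_right₀ hc (b := i * D)]
      push_cast
      constructor <;> intro h <;> linarith
    have hright : c * y < -(c * D) * (t + (-i : ℤ)) + c * D ↔ D * t + y < (i + 1) * D := by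
      rw [← mul_lt_mul_iff_right₀ hc (b := D * t + y)]
      push_cast
      constructor <;> intro h <;> linarith
    rw [mem_Ico, hleft, hright, mem_preimage, mem_ofPred_eq, inv_mul_cancel_left₀ hc.ne',
      Int.floor_eq_iff, le_div_iff₀ hD, div_lt_iff₀ hD]
  have hmeas : MeasurableSet {z : ℝ | ⌊(D * t + z) / D⌋ = i} :=
    measurableSet_eq_fun (by fun_prop) measurable_const
  rw [hmap, ← Measure.real, map_measureReal_apply (by fun_prop) hmeas, hset,
    gaussianReal_real_Ico (by nlinarith [mul_pos hc hD]), windowEnt]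

theorem scaled_entropy_eq_integral {D c : ℝ} (hD : 0 < D) (hc : 0 < c) :
    c * D * ((1 / D) * ∫ x in (0 : ℝ)..D, ∑' i : ℤ,
        entTerm ((gaussianReal 0 (Real.toNNReal (1 / c ^ 2)))
          {z : ℝ | ⌊(x + z) / D⌋ = i}).toReal)
      = ∫ u, windowEnt (c * D) u := by
  have hL : 0 < c * D := mul_pos hc hD
  set f : ℝ → ℝ := fun t => windowEnt (c * D) (-(c * D) * t) with hf
  have hfi : Integrable f := (integrable_windowEnt hL.le).comp_mul_left' (neg_ne_zero.2 hL.ne')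
  have hf0 : ∀ t, 0 ≤ f t := fun t => windowEnt_nonneg hL.le _
  have hsum := hfi.hasSum_intervalIntegral_comp_add_int
  have hswap : ∫ t in (0 : ℝ)..1, ∑' i : ℤ, f (t + i) = ∫ t, f t := by
    simp only [intervalIntegral.integral_of_le zero_le_one] at hsum ⊢
    rw [← integral_tsum_of_summable_integral_norm, hsum.tsum_eq]
    · exact fun i => (hfi.comp_add_right _).integrableOn
    · simpa only [Real.norm_of_nonneg (hf0 _)] using hsum.summable
  have hsc := intervalIntegral.mul_integral_comp_mul_left (a := 0) (b := 1) (f := fun x =>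
    ∑' i : ℤ, entTerm ((gaussianReal 0 (Real.toNNReal (1 / c ^ 2)))
          {z : ℝ | ⌊(x + z) / D⌋ = i}).toReal) D
  rw [mul_zero, mul_one] at hsc
  simp only [gaussianReal_floor_eq hD hc] at hsc
  have hre : ∀ t : ℝ, ∑' i : ℤ, windowEnt (c * D) (-(c * D) * (t + (-i : ℤ)))
      = ∑' i : ℤ, f (t + i) := fun t => (Equiv.neg ℤ).tsum_eq fun i : ℤ => f (t + i)
  simp only [hre, hswap] at hsc
  rw [← hsc, hf, Measure.integral_comp_mul_left, smul_eq_mul, abs_inv, abs_neg, abs_of_pos hL]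
  field_simp

/-- Asymptotics of the conditional entropy `M(c, D) = I(h(p) − h(q) | r(q))` of the
interval-hash difference for two points at distance `1/c`, given the offset of `q`
inside its length-`D` interval: as `c → ∞`, `c·D·M(c, D)` converges to
`2α = 2·∫₀^∞ H₂(Φ(x)) dx`. -/
theorem interval_hash_entropy_limit (D : ℝ) (hD : 0 < D) :
    Tendsto (fun c : ℝ => c * D * ((1 / D) * ∫ x in (0 : ℝ)..D, ∑' i : ℤ,
        entTerm ((gaussianReal 0 (Real.toNNReal (1 / c ^ 2)))
          {z : ℝ | ⌊(x + z) / D⌋ = i}).toReal))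
      atTop (nhds (2 * ∫ x in Set.Ioi (0 : ℝ), binEnt (stdNormalTail x))) := by
  refine (tendsto_integral_windowEnt.comp (tendsto_id.atTop_mul_const hD)).congr' ?_
  filter_upwards [eventually_gt_atTop 0] with c hc
  exact (scaled_entropy_eq_integral hD hc).symm
end

section
/- Let D = 3 and g = 1 − (1/D)·√(2/π)·(1 − e^{−D²/2}), and let α = ∫₀^∞ H₂(Φ(x)) dx. Then the exponent ρ = 2α/(D·log₂(1/g)) satisfies ρ < 2.1. (This is the exponent such that, by the entropy-based search method with interval hashing at width D = 3, a c-approximate nearest neighbor in Euclidean space can be found in time Õ(n^{ρ/c·(1+o(1))}) with near-linear space as c → ∞.) -/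
section

open MeasureTheory Filter Topology

lemma integrable_exp_neg_sq_div_two : Integrable fun t : ℝ => Real.exp (-(t ^ 2) / 2) := by
  have h := integrable_exp_neg_mul_sq (b := 1 / 2) (by norm_num)
  refine h.congr (Filter.Eventually.of_forall fun t => ?_)
  show Real.exp _ = Real.exp _
  congr 1
  ring

lemma stdNormalTail_zero : stdNormalTail 0 = 1 / 2 := by
  have h : ∫ t in Set.Ioi (0 : ℝ), Real.exp (-(t ^ 2) / 2) = Real.sqrt (2 * Real.pi) / 2 := by
    rw [show 2 * Real.pi = Real.pi / (1 / 2) by ring, ← integral_gaussian_Ioi]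
    congr 1
    ext t
    congr 1
    ring
  have hpos : 0 < Real.sqrt (2 * Real.pi) := by positivity
  rw [stdNormalTail, h]
  field_simp

lemma hasDerivAt_stdNormalTail (x : ℝ) :
    HasDerivAt stdNormalTail (-((Real.sqrt (2 * Real.pi))⁻¹ * Real.exp (-(x ^ 2) / 2))) x := by
  have hcont : Continuous fun t : ℝ => Real.exp (-(t ^ 2) / 2) := by fun_prop
  have heq : stdNormalTail = fun y => (Real.sqrt (2 * Real.pi))⁻¹ *
      ((∫ t in Set.Ioi (0 : ℝ), Real.exp (-(t ^ 2) / 2)) -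
        ∫ t in (0 : ℝ)..y, Real.exp (-(t ^ 2) / 2)) := by
    ext y
    rw [stdNormalTail, ← intervalIntegral.integral_Ioi_sub_Ioi'
      integrable_exp_neg_sq_div_two.integrableOn integrable_exp_neg_sq_div_two.integrableOn]
    ring
  rw [heq, ← mul_neg, ← zero_sub]
  exact ((hasDerivAt_const x _).sub (intervalIntegral.integral_hasDerivAt_right
    (hcont.intervalIntegrable _ _) (hcont.stronglyMeasurableAtFilter _ _)
    hcont.continuousAt)).const_mul _

lemma stdNormalTail_pos (x : ℝ) : 0 < stdNormalTail x := by
  refine mul_pos (by positivity) ?_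
  rw [setIntegral_pos_iff_support_of_nonneg_ae
    (Filter.Eventually.of_forall fun t => (Real.exp_pos _).le)
    integrable_exp_neg_sq_div_two.integrableOn]
  have : Function.support (fun t : ℝ => Real.exp (-(t ^ 2) / 2)) = Set.univ :=
    Set.eq_univ_of_forall fun t => (Real.exp_pos _).ne'
  simp [this]

lemma stdNormalTail_lt_one {x : ℝ} (hx : 0 ≤ x) : stdNormalTail x < 1 := by
  have hanti : Antitone stdNormalTail :=
    antitone_of_hasDerivAt_nonpos hasDerivAt_stdNormalTail fun y => by
      exact neg_nonpos.2 (by positivity)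
  have := hanti hx
  rw [stdNormalTail_zero] at this
  linarith

lemma exp_neg_sq_div_two_le (t : ℝ) :
    Real.exp (-(t ^ 2) / 2) ≤ Real.exp (1 / 2) * Real.exp (-t) := by
  rw [← Real.exp_add, Real.exp_le_exp]
  nlinarith [sq_nonneg (t - 1)]

lemma stdNormalTail_le (x : ℝ) :
    stdNormalTail x ≤ (Real.sqrt (2 * Real.pi))⁻¹ * (Real.exp (1 / 2) * Real.exp (-x)) := by
  refine mul_le_mul_of_nonneg_left ?_ (by positivity)
  rw [← integral_exp_neg_Ioi x, ← integral_const_mul]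
  exact setIntegral_mono integrable_exp_neg_sq_div_two.integrableOn
    ((integrableOn_exp_neg_Ioi x).const_mul _) exp_neg_sq_div_two_le

lemma tendsto_pow_mul_of_le_exp_neg {f : ℝ → ℝ} {C : ℝ} (n : ℕ) (hf : ∀ x, 0 ≤ f x)
    (hC : ∀ x, f x ≤ C * Real.exp (-x)) :
    Tendsto (fun x => x ^ n * f x) atTop (𝓝 0) := by
  have h := (Real.tendsto_pow_mul_exp_neg_atTop_nhds_zero n).const_mul C
  rw [mul_zero] at h
  refine squeeze_zero' ?_ ?_ h
  · filter_upwards [eventually_ge_atTop 0] with x hx using mul_nonneg (pow_nonneg hx n) (hf x)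
  · filter_upwards [eventually_ge_atTop 0] with x hx
    calc x ^ n * f x ≤ x ^ n * (C * Real.exp (-x)) :=
          mul_le_mul_of_nonneg_left (hC x) (pow_nonneg hx n)
      _ = C * (x ^ n * Real.exp (-x)) := by ring

/-- The antiderivative `(x² Φ(x) - x φ(x) - Φ(x)) / 2` of `x Φ(x)`. -/
lemma hasDerivAt_antideriv_mul_stdNormalTail (x : ℝ) :
    HasDerivAt (fun y => (y ^ 2 * stdNormalTail y - (Real.sqrt (2 * Real.pi))⁻¹ *
      (y ^ 1 * Real.exp (-(y ^ 2) / 2)) - y ^ 0 * stdNormalTail y) / 2)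
      (x * stdNormalTail x) x := by
  have hT := hasDerivAt_stdNormalTail x
  have hE : HasDerivAt (fun y : ℝ => Real.exp (-(y ^ 2) / 2))
      (Real.exp (-(x ^ 2) / 2) * (-(2 * x) / 2)) x := by
    simpa using (((hasDerivAt_pow 2 x).neg).div_const 2).exp
  refine ((((hasDerivAt_pow 2 x).mul hT).sub
    (((hasDerivAt_pow 1 x).mul hE).const_mul _)).sub
    ((hasDerivAt_pow 0 x).mul hT)).div_const 2 |>.congr_deriv ?_
  push_cast
  ring

lemma tendsto_antideriv_mul_stdNormalTail :
    Tendsto (fun y => (y ^ 2 * stdNormalTail y - (Real.sqrt (2 * Real.pi))⁻¹ *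
      (y ^ 1 * Real.exp (-(y ^ 2) / 2)) - y ^ 0 * stdNormalTail y) / 2) atTop (𝓝 0) := by
  have hT (n : ℕ) := tendsto_pow_mul_of_le_exp_neg n (fun x => (stdNormalTail_pos x).le)
    fun x => (stdNormalTail_le x).trans_eq (mul_assoc _ _ _).symm
  have hE := tendsto_pow_mul_of_le_exp_neg 1 (fun x => (Real.exp_pos _).le)
    exp_neg_sq_div_two_le
  simpa using (((hT 2).sub (hE.const_mul (Real.sqrt (2 * Real.pi))⁻¹)).sub (hT 0)).div_const 2

lemma integrableOn_mul_stdNormalTail :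
    IntegrableOn (fun x => x * stdNormalTail x) (Set.Ioi 0) :=
  integrableOn_Ioi_deriv_of_nonneg' (fun x _ => hasDerivAt_antideriv_mul_stdNormalTail x)
    (fun x hx => mul_nonneg (le_of_lt hx) (stdNormalTail_pos x).le)
    tendsto_antideriv_mul_stdNormalTail

lemma integral_mul_stdNormalTail :
    ∫ x in Set.Ioi (0 : ℝ), x * stdNormalTail x = 1 / 4 := by
  rw [integral_Ioi_of_hasDerivAt_of_tendsto'
    (fun x _ => hasDerivAt_antideriv_mul_stdNormalTail x) integrableOn_mul_stdNormalTail
    tendsto_antideriv_mul_stdNormalTail, stdNormalTail_zero]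
  norm_num

lemma binEnt_eq_binEntropy_div (w : ℝ) : binEnt w = Real.binEntropy w / Real.log 2 := by
  rw [binEnt, Real.binEntropy_eq_negMulLog_add_negMulLog_one_sub, Real.negMulLog, Real.negMulLog,
    Real.logb, Real.logb]
  ring

/-- Gibbs' inequality for the binary distribution with log-odds `s`. -/
lemma binEntropy_le_log_one_add_exp_neg {w : ℝ} (h0 : 0 < w) (h1 : w < 1) (s : ℝ) :
    Real.binEntropy w ≤ Real.log (1 + Real.exp (-s)) + w * s := by
  have h1' : 0 < 1 - w := by linarith
  have hq : 0 < 1 + Real.exp (-s) := by positivity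
  have hA := Real.log_le_sub_one_of_pos
    (show 0 < Real.exp (-s) / (1 + Real.exp (-s)) / w by positivity)
  have hB := Real.log_le_sub_one_of_pos (show 0 < 1 / (1 + Real.exp (-s)) / (1 - w) by positivity)
  rw [Real.log_div (by positivity) h0.ne', Real.log_div (by positivity) hq.ne', Real.log_exp] at hA
  rw [Real.log_div (by positivity) h1'.ne', Real.log_div one_ne_zero hq.ne', Real.log_one] at hB
  have hsum : w * (Real.exp (-s) / (1 + Real.exp (-s)) / w - 1) +
      (1 - w) * (1 / (1 + Real.exp (-s)) / (1 - w) - 1) = 0 := by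
    field_simp
    ring
  rw [Real.binEntropy_eq_negMulLog_add_negMulLog_one_sub, Real.negMulLog, Real.negMulLog]
  nlinarith [mul_le_mul_of_nonneg_left hA h0.le, mul_le_mul_of_nonneg_left hB h1'.le]

lemma log_one_add_le_sub_sq_div_four {u : ℝ} (h0 : 0 ≤ u) (h1 : u ≤ 1) :
    Real.log (1 + u) ≤ u - u ^ 2 / 4 := by
  have hd : ∀ x ∈ interior (Set.Icc (0 : ℝ) 1),
      HasDerivWithinAt (fun u : ℝ => u - u ^ 2 / 4 - Real.log (1 + u))
        (1 - 2 * x / 4 - 1 / (1 + x)) (interior (Set.Icc (0 : ℝ) 1)) x := by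
    intro x hx
    rw [interior_Icc] at hx
    have hx0 : 1 + x ≠ 0 := by linarith [hx.1]
    have := (((hasDerivAt_id x).sub ((hasDerivAt_pow 2 x).div_const 4)).sub
      (((hasDerivAt_id x).const_add 1).log hx0))
    exact (this.congr_deriv (by simp)).hasDerivWithinAt
  have hmono := monotoneOn_of_hasDerivWithinAt_nonneg (convex_Icc (0 : ℝ) 1) (by
    refine ContinuousOn.sub (by fun_prop) (ContinuousOn.log (by fun_prop) fun x hx => ?_)
    linarith [hx.1]) hd (by
    intro x hx
    rw [interior_Icc] at hx
    have hx0 : 0 < 1 + x := by linarith [hx.1]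
    rw [sub_nonneg, div_le_iff₀ hx0]
    nlinarith [mul_nonneg hx.1.le (sub_nonneg.2 hx.2.le)])
  have := hmono (Set.left_mem_Icc.2 zero_le_one) ⟨h0, h1⟩ h0
  simp only [add_zero, Real.log_one] at this
  linarith

lemma binEntropy_stdNormalTail_le {x : ℝ} (hx : 0 < x) :
    Real.binEntropy (stdNormalTail x) ≤
      Real.exp (-2 * x) - Real.exp (-4 * x) / 4 + 2 * (x * stdNormalTail x) := by
  have h1 := binEntropy_le_log_one_add_exp_neg (stdNormalTail_pos x)
    (stdNormalTail_lt_one hx.le) (2 * x)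
  have h2 := log_one_add_le_sub_sq_div_four (Real.exp_pos (-(2 * x))).le
    (Real.exp_le_one_iff.2 (by linarith))
  rw [← Real.exp_nat_mul, show ((2 : ℕ) : ℝ) * -(2 * x) = -4 * x by push_cast; ring,
    ← neg_mul] at h2
  rw [← neg_mul] at h1
  linarith

lemma integral_binEntropy_stdNormalTail_le :
    ∫ x in Set.Ioi (0 : ℝ), Real.binEntropy (stdNormalTail x) ≤ 15 / 16 := by
  have i2 := integrableOn_exp_mul_Ioi (show (-2 : ℝ) < 0 by norm_num) 0
  have i4 := (integrableOn_exp_mul_Ioi (show (-4 : ℝ) < 0 by norm_num) 0).div_const 4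
  have iT := integrableOn_mul_stdNormalTail.const_mul 2
  have i24 : IntegrableOn (fun x : ℝ => Real.exp (-2 * x) - Real.exp (-4 * x) / 4) (Set.Ioi 0) :=
    i2.sub i4
  calc ∫ x in Set.Ioi (0 : ℝ), Real.binEntropy (stdNormalTail x)
      ≤ ∫ x in Set.Ioi (0 : ℝ),
          (Real.exp (-2 * x) - Real.exp (-4 * x) / 4 + 2 * (x * stdNormalTail x)) := by
        refine integral_mono_of_nonneg ?_ (i24.add iT) ?_
        · filter_upwards [ae_restrict_mem measurableSet_Ioi] with x hx using
            Real.binEntropy_nonneg (stdNormalTail_pos x).le (stdNormalTail_lt_one (le_of_lt hx)).le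
        · filter_upwards [ae_restrict_mem measurableSet_Ioi] with x hx using
            binEntropy_stdNormalTail_le hx
    _ = 15 / 16 := by
        rw [integral_add i24 iT, integral_sub i2 i4, integral_div, integral_const_mul,
          integral_mul_stdNormalTail, integral_exp_mul_Ioi (by norm_num),
          integral_exp_mul_Ioi (by norm_num)]
        norm_num

lemma collision_bound_pos_le {g : ℝ}
    (hg : g = 1 - (1 / 3) * Real.sqrt (2 / Real.pi) * (1 - Real.exp (-(3 ^ 2) / 2))) :
    0 < g ∧ g ≤ 0.74 := by
  have hs0 : 0.797 ≤ Real.sqrt (2 / Real.pi) := by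
    refine Real.le_sqrt_of_sq_le ?_
    rw [le_div_iff₀ Real.pi_pos]
    nlinarith [Real.pi_lt_d4]
  have hs1 : Real.sqrt (2 / Real.pi) ≤ 1 := by
    rw [Real.sqrt_le_one, div_le_one Real.pi_pos]
    linarith [Real.pi_gt_three]
  have he : Real.exp (-(3 ^ 2) / 2) ≤ 1 / 54 := by
    have h4 : (54 : ℝ) ≤ Real.exp 4 := by
      have := Real.exp_one_gt_d9
      rw [show (4 : ℝ) = (4 : ℕ) * 1 by norm_num, Real.exp_nat_mul]
      calc (54 : ℝ) ≤ 2.718 ^ 4 := by norm_num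
        _ ≤ _ := pow_le_pow_left₀ (by norm_num) (by linarith) 4
    calc Real.exp (-(3 ^ 2) / 2) ≤ Real.exp (-4) := Real.exp_le_exp.2 (by norm_num)
      _ = 1 / Real.exp 4 := by rw [Real.exp_neg, one_div]
      _ ≤ 1 / 54 := one_div_le_one_div_of_le (by norm_num) h4
  have he0 := Real.exp_pos (-(3 ^ 2) / 2)
  constructor <;> nlinarith

lemma three_tenths_le_log_one_div {g : ℝ} (h0 : 0 < g) (h1 : g ≤ 0.74) :
    0.3 ≤ Real.log (1 / g) := by
  have h10 : Real.exp 0.3 ^ 10 ≤ (1 / 0.74 : ℝ) ^ 10 := by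
    have := Real.exp_one_lt_d9
    have he : Real.exp 0.3 ^ 10 = Real.exp 1 ^ 3 := by
      rw [← Real.exp_nat_mul, ← Real.exp_nat_mul]
      norm_num
    rw [he]
    calc Real.exp 1 ^ 3 ≤ 2.7183 ^ 3 := pow_le_pow_left₀ (Real.exp_pos 1).le (by linarith) 3
      _ ≤ _ := by norm_num
  rw [Real.le_log_iff_exp_le (by positivity)]
  exact (le_of_pow_le_pow_left₀ (by norm_num) (by norm_num) h10).trans
    (one_div_le_one_div_of_le h0 h1)

end

/-- With interval width `D = 3`, collision bound `g = 1 − (1/D)·√(2/π)·(1 − e^{−D²/2})`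
and `α = ∫₀^∞ H₂(Φ(x)) dx`, the exponent `ρ = 2α/(D·log₂(1/g))` of the entropy-based
nearest-neighbor search satisfies `ρ < 2.1`. -/
theorem search_exponent_lt (D g α ρ : ℝ) (hD : D = 3)
    (hg : g = 1 - (1 / D) * Real.sqrt (2 / Real.pi) * (1 - Real.exp (-(D ^ 2) / 2)))
    (hα : α = ∫ x in Set.Ioi (0 : ℝ), binEnt (stdNormalTail x))
    (hρ : ρ = 2 * α / (D * Real.logb 2 (1 / g))) :
    ρ < 2.1 := by
  subst hD
  obtain ⟨hg0, hg1⟩ := collision_bound_pos_le hg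
  have hlog := three_tenths_le_log_one_div hg0 hg1
  have hlog2 : 0 < Real.log 2 := Real.log_pos one_lt_two
  have hα' : α * Real.log 2 ≤ 15 / 16 := by
    simp only [hα, binEnt_eq_binEntropy_div, MeasureTheory.integral_div]
    rw [div_mul_cancel₀ _ hlog2.ne']
    exact integral_binEntropy_stdNormalTail_le
  have hρ' : ρ = 2 * (α * Real.log 2) / (3 * Real.log (1 / g)) := by
    rw [hρ, Real.logb]
    field_simp
  rw [hρ', div_lt_iff₀ (by positivity)]
  linarith
end
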